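/- arXiv:2507.08642 — 2 statements merged into one kernel-verified Lean document; each statement's English description precedes it below -/
import Mathlib

section
/- Let R be a henselian local ring with residue field k, and let A be a smooth R-algebra of finite presentation. Then the reduction map A(R) → A(k) on R-points and k-points is surjective; i.e. every k-algebra homomorphism A ⊗_R k → k lifts to an R-algebra homomorphism A → R. -/
universe u

open Polynomial in
/-- Lifting for a standard etale algebra over a ring `B` mapping to a henselian local ring. -/
theorem lift_standardEtale (R B S : Type u) [CommRing R] [HenselianLocalRing R]
    [CommRing B] [CommRing S] [Algebra B S] (P : StandardEtalePresentation B S)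
    [Algebra B R]
    (g : S →ₐ[B] IsLocalRing.ResidueField R) :
    ∃ f : S →ₐ[B] R,
      ((IsScalarTower.toAlgHom B R (IsLocalRing.ResidueField R)).comp f) = g := by
  have hm : P.HasMap (g P.x) := P.hasMap.map g
  have hd := hm.isUnit_derivative_f
  obtain ⟨a, ha, hga⟩ := (((HenselianLocalRing.TFAE R).out 0 1 :
    HenselianLocalRing R ↔ ∀ f : R[X], f.Monic → ∀ a₀ : IsLocalRing.ResidueField R,
      aeval a₀ f = 0 → aeval a₀ (derivative f) ≠ 0 →
        ∃ a : R, f.IsRoot a ∧ IsLocalRing.residue R a = a₀).mp inferInstance)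
    (P.f.map (algebraMap B R)) (P.monic_f.map _) (g P.x)
    (by rw [aeval_map_algebraMap]; exact hm.1)
    (by rw [derivative_map, aeval_map_algebraMap]; exact hd.ne_zero)
  have hM : P.HasMap a := by
    refine ⟨?_, ?_⟩
    · rw [IsRoot.def, eval_map_algebraMap] at ha
      exact ha
    · have h2 := hm.2
      rw [← hga, ← IsLocalRing.ResidueField.algebraMap_eq, aeval_algebraMap_apply] at h2
      exact IsUnit.of_map (IsLocalRing.residue R) _ h2
  refine ⟨(P.lift a hM).comp P.equivRing.toAlgHom, P.hom_ext ?_⟩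
  simpa using hga

/-- Ring homomorphism version of `lift_standardEtale`. -/
theorem lift_standardEtale_ringHom (R B S : Type u) [CommRing R] [HenselianLocalRing R]
    [CommRing B] [CommRing S] [Algebra B S] (P : StandardEtalePresentation B S)
    (φ : B →+* R) (g : S →+* IsLocalRing.ResidueField R)
    (h : ∀ b, g (algebraMap B S b) = IsLocalRing.residue R (φ b)) :
    ∃ f : S →+* R, (∀ b, f (algebraMap B S b) = φ b) ∧
      (IsLocalRing.residue R).comp f = g := by
  let : Algebra B R := φ.toAlgebra
  obtain ⟨f, hf⟩ := lift_standardEtale R B S P { g with commutes' := h }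
  exact ⟨f, fun b => f.commutes b, RingHom.ext fun x => DFunLike.congr_fun hf x⟩

/-- Let `R` be a henselian local ring with residue field `k` and `A` a smooth
`R`-algebra of finite presentation.  Then the reduction map `A(R) → A(k)` is
surjective: every `k`-point of `A` (equivalently, every `R`-algebra
homomorphism `A → k`) lifts to an `R`-point `A → R`. -/
theorem stmt14 (R : Type u) [CommRing R] [HenselianLocalRing R]
    (A : Type u) [CommRing A] [Algebra R A] [Algebra.Smooth R A]
    (g : A →ₐ[R] IsLocalRing.ResidueField R) :
    ∃ f : A →ₐ[R] R,
      (IsLocalRing.residue R).comp (f : A →+* R) = (g : A →+* IsLocalRing.ResidueField R) := by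
  have hp : (RingHom.ker g).IsPrime := RingHom.ker_isPrime _
  obtain ⟨s, hs, n, _, _, hE⟩ :=
    Algebra.IsSmoothAt.exists_isStandardEtale_mvPolynomial (R := R) (p := RingHom.ker g)
  obtain ⟨⟨P⟩⟩ := hE
  have hu : ∀ y : Submonoid.powers s, IsUnit (g y) := by
    rintro ⟨_, k, rfl⟩
    simp only [map_pow]
    exact (IsUnit.mk0 _ hs).pow k
  let g' : Localization.Away s →ₐ[R] IsLocalRing.ResidueField R := IsLocalization.liftAlgHom hu
  have hg' : ∀ x : A, g' (algebraMap A _ x) = g x := fun x => by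
    simp [g']
  let B := MvPolynomial (Fin n) R
  choose r hr using fun i : Fin n =>
    IsLocalRing.residue_surjective (g' (algebraMap B _ (MvPolynomial.X i)))
  let φ : B →ₐ[R] R := MvPolynomial.aeval r
  have hφ : (Algebra.ofId R (IsLocalRing.ResidueField R)).comp φ =
      g'.comp (IsScalarTower.toAlgHom R B (Localization.Away s)) := by
    refine MvPolynomial.algHom_ext fun i => ?_
    simp only [AlgHom.comp_apply, φ, MvPolynomial.aeval_X]
    exact hr i
  obtain ⟨f, hf, hfg⟩ := lift_standardEtale_ringHom R B (Localization.Away s) P φ.toRingHom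
    g'.toRingHom (fun b => (DFunLike.congr_fun hφ b).symm)
  refine ⟨{ f.comp (algebraMap A (Localization.Away s)) with commutes' := fun x => ?_ }, ?_⟩
  · change f (algebraMap A _ (algebraMap R A x)) = _
    rw [← IsScalarTower.algebraMap_apply R A, IsScalarTower.algebraMap_apply R B, hf]
    exact φ.commutes x
  · ext x
    exact (DFunLike.congr_fun hfg (algebraMap A _ x)).trans (hg' x)
end

section
/- Lang–Nishimura theorem for schemes: Let k be a field, X an integral scheme of finite type over k, Y a proper scheme over k, and φ : X ⇢ Y a rational map (a morphism defined on a dense open subscheme). If X has a k-rational point x such that the local ring O_{X,x} is regular, then Y has a k-rational point. -/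
open AlgebraicGeometry CategoryTheory

universe u

/-- A (Noetherian) local ring is *regular* if its maximal ideal can be
generated by `dim A` elements, where `dim` is the Krull dimension. -/
def IsRegularLocal (A : Type u) [CommRing A] [IsLocalRing A] : Prop :=
  IsNoetherianRing A ∧ ∃ s : Finset A,
    Ideal.span (s : Set A) = IsLocalRing.maximalIdeal A ∧
    (s.card : WithBot (WithTop ℕ)) = ringKrullDim A

section LangNishimuraAux

open IsLocalRing

/-- the maximal ideal is generated by at most `n ≤ dim A` elements -/
def RegLE (n : ℕ) (A : Type u) [CommRing A] [IsLocalRing A] : Prop :=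
  (∃ s : Finset A, Ideal.span (s : Set A) = maximalIdeal A ∧ s.card ≤ n) ∧
    (n : WithBot ℕ∞) ≤ ringKrullDim A

lemma regLE_quotient {n : ℕ} {A : Type u} [CommRing A] [IsLocalRing A] [IsNoetherianRing A]
    (h : RegLE (n + 1) A) {x : A} (hx : x ∈ maximalIdeal A) (hx2 : x ∉ maximalIdeal A ^ 2)
    [IsLocalRing (A ⧸ Ideal.span {x})] : RegLE n (A ⧸ Ideal.span {x}) := by
  classical
  obtain ⟨⟨s, hs, hc⟩, hd⟩ := h
  constructor
  · have hxs := hx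
    rw [← hs] at hxs
    obtain ⟨a, -, ha⟩ := Submodule.mem_span_finset.mp hxs
    have : ∃ t ∈ s, a t ∉ maximalIdeal A := by
      by_contra! hcon
      apply hx2
      rw [← ha, pow_two]
      refine Ideal.sum_mem _ fun t ht => Ideal.mul_mem_mul (hcon t ht) ?_
      rw [← hs]; exact Ideal.subset_span ht
    obtain ⟨t, ht, hat⟩ := this
    obtain ⟨b, hb⟩ := (IsLocalRing.notMem_maximalIdeal.mp hat).exists_left_inv
    have hmax : maximalIdeal (A ⧸ Ideal.span {x}) =
        (maximalIdeal A).map (Ideal.Quotient.mk (Ideal.span {x})) := by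
      symm
      apply IsLocalRing.eq_maximalIdeal
      apply (Ideal.map_eq_top_or_isMaximal_of_surjective _ Ideal.Quotient.mk_surjective
        (maximalIdeal.isMaximal A)).resolve_left
      intro htop
      have h1 := Ideal.comap_map_of_surjective (Ideal.Quotient.mk (Ideal.span {x}))
        Ideal.Quotient.mk_surjective (maximalIdeal A)
      rw [htop, Ideal.comap_top, ← RingHom.ker_eq_comap_bot, Ideal.mk_ker, sup_eq_left.mpr] at h1
      · exact (maximalIdeal.isMaximal A).ne_top h1.symm
      · simpa [Ideal.span_le] using hx
    refine ⟨(s.erase t).image (Ideal.Quotient.mk (Ideal.span {x})), ?_, ?_⟩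
    · rw [hmax, ← hs, Ideal.map_span]
      apply le_antisymm
      · apply Ideal.span_mono
        rw [Finset.coe_image]
        exact Set.image_mono (by simp)
      · rw [Ideal.span_le]
        have hmem : ∀ r ∈ s.erase t, Ideal.Quotient.mk (Ideal.span {x}) r ∈ Ideal.span
          (((s.erase t).image (Ideal.Quotient.mk (Ideal.span {x})) : Finset _) : Set (A ⧸ Ideal.span {x})) := by
          intro r hr
          apply Ideal.subset_span
          exact Finset.mem_coe.mpr (Finset.mem_image_of_mem _ hr)
        rintro _ ⟨r, hr, rfl⟩
        by_cases hrt : r = t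
        · subst hrt
          have h0 : Ideal.Quotient.mk (Ideal.span {x}) x = 0 :=
            Ideal.Quotient.eq_zero_iff_mem.mpr (Ideal.mem_span_singleton_self x)
          rw [← Finset.add_sum_erase s _ ht] at ha
          have h2 : r = b * x - b * ∑ y ∈ s.erase r, a y • y := by
            rw [← ha]; simp only [smul_eq_mul]; linear_combination (-r) * hb
          suffices Ideal.Quotient.mk (Ideal.span {x})
              (b * x - b * ∑ y ∈ s.erase r, a y • y) ∈ Ideal.span
              (((s.erase r).image (Ideal.Quotient.mk (Ideal.span {x})) : Finset _) :
                Set (A ⧸ Ideal.span {x})) from by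
            rw [← h2] at this; exact this
          rw [map_sub, map_mul, h0, mul_zero, zero_sub, map_mul, map_sum]
          refine neg_mem (Ideal.mul_mem_left _ _ (Ideal.sum_mem _ fun y hy => ?_))
          rw [smul_eq_mul, map_mul]
          exact Ideal.mul_mem_left _ _ (hmem y hy)
        · exact hmem r (Finset.mem_erase.mpr ⟨hrt, hr⟩)
    · refine Finset.card_image_le.trans ?_
      rw [Finset.card_erase_of_mem ht]; omega
  · have := ringKrullDim_le_ringKrullDim_quotient_add_card {x} (by
      rw [IsLocalRing.ringJacobson_eq_maximalIdeal]; simpa using hx)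
    rw [Finset.coe_singleton, Finset.card_singleton] at this
    have h3 := hd.trans this
    rw [Nat.cast_add] at h3
    exact (ENat.WithBot.add_le_add_natCast_right_iff).mp h3

lemma localQ {A : Type u} [CommRing A] [IsLocalRing A] {x : A} (hx : x ∈ maximalIdeal A) :
    IsLocalRing (A ⧸ Ideal.span {x}) := by
  have : Nontrivial (A ⧸ Ideal.span {x}) := by
    rw [Ideal.Quotient.nontrivial_iff]
    intro h
    have : Ideal.span {x} ≤ maximalIdeal A := by simpa [Ideal.span_le] using hx
    rw [h] at this
    exact (maximalIdeal.isMaximal A).ne_top (top_le_iff.mp this)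
  exact IsLocalRing.of_surjective' (Ideal.Quotient.mk (Ideal.span {x})) Ideal.Quotient.mk_surjective

lemma regLE_exists {n : ℕ} {A : Type u} [CommRing A] [IsLocalRing A] [IsNoetherianRing A]
    (h : RegLE (n + 1) A) : ∃ x ∈ maximalIdeal A, x ∉ maximalIdeal A ^ 2 ∧
      ∀ q ∈ minimalPrimes A, x ∉ q := by
  have hdim : ¬ ringKrullDim A ≤ 0 := by
    intro h0
    have := h.2.trans h0
    norm_cast at this
  by_contra! hcon
  have hfin : (insert (maximalIdeal A ^ 2) (minimalPrimes A)).Finite :=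
    (minimalPrimes.finite_of_isNoetherianRing A).insert _
  have := (Ideal.subset_union_prime_finite hfin (f := id) (maximalIdeal A ^ 2) (maximalIdeal A ^ 2)
    (I := maximalIdeal A) (by
      rintro i (rfl | hi) h1 -
      · exact absurd rfl h1
      · exact hi.1.1)).mp (by
      intro x hx
      by_cases hx2 : x ∈ maximalIdeal A ^ 2
      · exact Set.mem_biUnion (Set.mem_insert _ _) hx2
      · obtain ⟨q, hq, hxq⟩ := hcon x hx hx2
        exact Set.mem_biUnion (Set.mem_insert_of_mem _ hq) hxq)
  obtain ⟨i, (rfl | hi), hle⟩ := this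
  · have hbot : maximalIdeal A = ⊥ := by
      apply Submodule.eq_bot_of_le_smul_of_le_jacobson_bot (maximalIdeal A) _
        (IsNoetherian.noetherian _)
      · simpa [pow_two] using hle
      · exact (IsLocalRing.jacobson_eq_maximalIdeal ⊥ bot_ne_top).ge
    have := IsLocalRing.isField_iff_maximalIdeal_eq.mpr hbot
    exact hdim (ringKrullDim_eq_zero_of_isField this).le
  · apply hdim
    rw [← IsLocalRing.maximalIdeal_height_eq_ringKrullDim]
    have : maximalIdeal A ∈ minimalPrimes A := by
      have : maximalIdeal A = i := (maximalIdeal.isMaximal A).eq_of_le hi.1.1.ne_top hle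
      rwa [this]
    have := Ideal.height_eq_zero_iff.mpr this
    simp [this]

lemma regLE_isDomain (n : ℕ) : ∀ (A : Type u) [CommRing A] [IsLocalRing A] [IsNoetherianRing A]
    (_ : RegLE n A), IsDomain A := by
  induction n with
  | zero =>
    intro A _ _ _ h
    obtain ⟨⟨s, hs, hc⟩, -⟩ := h
    have : s = ∅ := by simpa using hc
    subst this
    exact (IsLocalRing.isField_iff_maximalIdeal_eq.mpr (by simpa using hs.symm)).isDomain
  | succ n ih =>
    intro A _ _ _ h
    obtain ⟨x, hx, hx2, hq⟩ := regLE_exists h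
    have := localQ hx
    have := ih _ (regLE_quotient h hx hx2)
    have hp : (Ideal.span {x}).IsPrime := (Ideal.Quotient.isDomain_iff_prime _).mp this
    obtain ⟨q, hqm, hqx⟩ := Ideal.exists_minimalPrimes_le (I := (⊥ : Ideal A)) (J := Ideal.span {x}) bot_le
    have hqp : q.IsPrime := hqm.1.1
    have hq0 : q = ⊥ := by
      apply Submodule.eq_bot_of_le_smul_of_le_jacobson_bot (maximalIdeal A) _
        (IsNoetherian.noetherian _)
      · intro y hy
        obtain ⟨c, rfl⟩ := Ideal.mem_span_singleton.mp (hqx hy)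
        exact Ideal.mul_mem_mul hx ((hqp.mem_or_mem hy).resolve_left (hq q hqm))
      · exact (IsLocalRing.jacobson_eq_maximalIdeal ⊥ bot_ne_top).ge
    subst hq0
    exact IsDomain.of_bot_isPrime A

open AlgebraicGeometry CategoryTheory IsLocalRing in
lemma point_descent (k : Type u) [Field k] (Y : Scheme.{u})
    (sY : Y ⟶ Spec (CommRingCat.of k)) [IsProper sY] (n : ℕ) :
    ∀ (A : Type u) [CommRing A] [IsLocalRing A] [IsNoetherianRing A] [IsDomain A]
      (i : k →+* A) (_ : ∀ a : A, ∃ c : k, a - i c ∈ maximalIdeal A) (_ : RegLE n A)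
      (K : Type u) [Field K] [Algebra A K] [IsFractionRing A K]
      (f : Spec (CommRingCat.of K) ⟶ Y)
      (_ : f ≫ sY = Spec.map (CommRingCat.ofHom ((algebraMap A K).comp i))),
      ∃ y : Spec (CommRingCat.of k) ⟶ Y, y ≫ sY = 𝟙 _ := by
  induction n with
  | zero =>
    intro A _ _ _ _ i hi h K _ _ _ f hf
    obtain ⟨⟨s, hs, hc⟩, -⟩ := h
    have : s = ∅ := by simpa using hc
    subst this
    have hbot : maximalIdeal A = ⊥ := by simpa using hs.symm
    have hA := IsLocalRing.isField_iff_maximalIdeal_eq.mpr hbot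
    have hsurj : Function.Surjective i := fun a => by
      obtain ⟨c, hc⟩ := hi a
      rw [hbot, Ideal.mem_bot, sub_eq_zero] at hc
      exact ⟨c, hc.symm⟩
    have hK : Function.Bijective (algebraMap A K) :=
      ⟨IsFractionRing.injective A K, (IsFractionRing.surjective_iff_isField).mpr hA⟩
    let e : k ≃+* K := RingEquiv.ofBijective ((algebraMap A K).comp i)
      ⟨RingHom.injective _, hK.2.comp hsurj⟩
    refine ⟨Spec.map (CommRingCat.ofHom (e.symm : K →+* k)) ≫ f, ?_⟩
    rw [Category.assoc, hf, ← Spec.map_comp, ← CommRingCat.ofHom_comp, ← Spec.map_id]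
    congr 1
    ext c
    exact e.symm_apply_apply c
  | succ n ih =>
    intro A _ _ _ _ i hi h K _ _ _ f hf
    obtain ⟨x, hx, hx2, hq⟩ := regLE_exists h
    have hlocal := localQ hx
    have hreg := regLE_quotient h hx hx2
    have hdom := regLE_isDomain n _ hreg
    have hp : (Ideal.span {x}).IsPrime := (Ideal.Quotient.isDomain_iff_prime _).mp hdom
    generalize hP : Ideal.span {x} = P at *
    let R := Localization.AtPrime P
    have hRd : IsDomain R := IsLocalization.isDomain_localization P.primeCompl_le_nonZeroDivisors
    have hRn : IsNoetherianRing R := IsLocalization.isNoetherianRing P.primeCompl R inferInstance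
    have hRp : (maximalIdeal R).IsPrincipal := by
      have h1 : P.map (algebraMap A R) = Ideal.span {algebraMap A R x} := by
        have h2 := congrArg (Ideal.map (algebraMap A R)) hP
        rw [Ideal.map_span, Set.image_singleton] at h2
        exact h2.symm
      rw [← Localization.AtPrime.map_eq_maximalIdeal, h1]
      exact ⟨_, rfl⟩
    have hval : ValuationRing R :=
      ((tfae_of_isNoetherianRing_of_isLocalRing_of_isDomain R).out 4 1).mp hRp
    have hu : ∀ y : P.primeCompl, IsUnit (algebraMap A K y) := fun y => by
      rw [isUnit_iff_ne_zero]
      exact map_ne_zero_of_mem_nonZeroDivisors _ (IsFractionRing.injective A K)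
        (P.primeCompl_le_nonZeroDivisors y.2)
    let _ : Algebra R K := (IsLocalization.lift (M := P.primeCompl) (S := R) hu).toAlgebra
    have hst : IsScalarTower A R K := .of_algebraMap_eq' (IsLocalization.lift_comp hu).symm
    have hfr : IsFractionRing R K :=
      IsFractionRing.isFractionRing_of_isDomain_of_isLocalization P.primeCompl R K
    let S : ValuativeCommSq sY :=
      { R := R, K := K, i₁ := f
        i₂ := Spec.map (CommRingCat.ofHom ((algebraMap A R).comp i))
        commSq := ⟨by
          rw [hf, ← Spec.map_comp, ← CommRingCat.ofHom_comp, ← RingHom.comp_assoc,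
            ← IsScalarTower.algebraMap_eq]⟩ }
    have hex : ValuativeCriterion.Existence sY := by
      have : ValuativeCriterion sY := by
        have h := ‹IsProper sY›
        rw [IsProper.eq_valuativeCriterion] at h
        exact h.1.1.1
      exact this.existence
    have hlift := hex S
    let g : Spec (CommRingCat.of R) ⟶ Y := S.commSq.lift
    have hg : g ≫ sY = Spec.map (CommRingCat.ofHom ((algebraMap A R).comp i)) :=
      S.commSq.fac_right
    refine ih (A ⧸ P) ((Ideal.Quotient.mk P).comp i) ?_ hreg P.ResidueField
      (Spec.map (CommRingCat.ofHom (algebraMap R P.ResidueField)) ≫ g) ?_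
    · intro a
      obtain ⟨a, rfl⟩ := Ideal.Quotient.mk_surjective a
      obtain ⟨c, hc⟩ := hi a
      refine ⟨c, ?_⟩
      rw [RingHom.comp_apply, ← map_sub]
      have : IsLocalHom (Ideal.Quotient.mk P) :=
        .of_surjective _ Ideal.Quotient.mk_surjective
      have h3 : (maximalIdeal A).map (Ideal.Quotient.mk P) ≤ maximalIdeal (A ⧸ P) :=
        ((IsLocalRing.local_hom_TFAE (Ideal.Quotient.mk P)).out 0 2).mp this
      exact h3 (Ideal.mem_map_of_mem _ hc)
    · rw [Category.assoc, hg, ← Spec.map_comp, ← CommRingCat.ofHom_comp]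
      rfl

end LangNishimuraAux

/-- **Lang–Nishimura**: let `k` be a field, `X` an integral scheme of finite
type over `k`, `Y` a proper scheme over `k`, and `φ : X ⇢ Y` a rational map
over `k` (a morphism defined on a dense open `U ⊆ X`).  If `X` has a
`k`-rational point `x` (a section of the structure morphism) at which the
local ring `O_{X,x}` is regular, then `Y` has a `k`-rational point. -/
theorem stmt15 (k : Type u) [Field k] (X Y : Scheme.{u})
    (sX : X ⟶ Spec (CommRingCat.of k)) (sY : Y ⟶ Spec (CommRingCat.of k))
    [IsIntegral X] [LocallyOfFiniteType sX] [CompactSpace X] [IsProper sY]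
    (U : X.Opens) (hU : Dense (U : Set X)) (φ : U.toScheme ⟶ Y)
    (hφ : φ ≫ sY = U.ι ≫ sX)
    (x : Spec (CommRingCat.of k) ⟶ X) (hx : x ≫ sX = 𝟙 _)
    (hreg : ∀ q, IsRegularLocal (X.presheaf.stalk (x.base q))) :
    ∃ y : Spec (CommRingCat.of k) ⟶ Y, y ≫ sY = 𝟙 _ := by
  let p : X := x (IsLocalRing.closedPoint k)
  obtain ⟨hN, s, hs, hd⟩ : IsRegularLocal (X.presheaf.stalk p) := hreg _
  let i : CommRingCat.of k ⟶ X.presheaf.stalk p := Spec.preimage (X.fromSpecStalk p ≫ sX)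
  have hi : Spec.map i = X.fromSpecStalk p ≫ sX := Spec.map_preimage _
  let π : X.presheaf.stalk p ⟶ CommRingCat.of k := Scheme.stalkClosedPointTo x
  have hπ : Spec.map π ≫ X.fromSpecStalk p = x := Scheme.Spec_stalkClosedPointTo_fromSpecStalk x
  have hloc : IsLocalHom π.hom := Scheme.isLocalHom_stalkClosedPointTo' x
  have hiπ : i ≫ π = 𝟙 _ := by
    apply Spec.map_injective
    rw [Spec.map_comp, hi, ← Category.assoc, hπ, hx, Spec.map_id]
  have hne : (U : Set X).Nonempty := hU.nonempty
  have hη : genericPoint X ∈ U :=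
    ((genericPoint_spec X).mem_open_set_iff U.isOpen).mpr (by simpa using hne)
  have hrange : Set.range (X.fromSpecStalk (genericPoint X)) ⊆ Set.range U.ι := by
    rw [Scheme.range_fromSpecStalk, Scheme.Opens.range_ι]
    intro y hy
    exact hy.mem_open U.isOpen hη
  let g : Spec (X.presheaf.stalk (genericPoint X)) ⟶ U.toScheme :=
    IsOpenImmersion.lift U.ι (X.fromSpecStalk (genericPoint X)) hrange
  have hg : g ≫ U.ι = X.fromSpecStalk (genericPoint X) := IsOpenImmersion.lift_fac _ _ _
  refine point_descent k Y sY s.card (X.presheaf.stalk p) i.hom ?_ ⟨⟨s, hs, le_rfl⟩, hd.le⟩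
    X.functionField (g ≫ φ) ?_
  · intro a
    refine ⟨π a, ?_⟩
    rw [IsLocalRing.mem_maximalIdeal, mem_nonunits_iff]
    intro hunit
    have h1 := hunit.map π.hom
    have h2 : π.hom (i.hom (π a)) = π a := by
      have h3 := congrArg (fun m => m.hom (π a)) hiπ
      exact h3
    rw [map_sub, h2] at h1
    exact h1.ne_zero (sub_self _)
  · rw [Category.assoc, hφ, ← Category.assoc, hg,
      ← Scheme.SpecMap_stalkSpecializes_fromSpecStalk
        ((genericPoint_spec X).specializes (Set.mem_univ p)), Category.assoc, ← hi, ← Spec.map_comp]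
    rfl
end
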